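/- Let F be ℝ or ℂ and let p, q ≥ 1. The image of the linear map S ↦ S J_q − J_p S from F^{p×q} to F^{p×q} is exactly the set of matrices C = [c_{ij}] ∈ F^{p×q} with the following property: for every integer t, if the diagonal D_t = {(i,j) : i − j = t, 1 ≤ i ≤ p, 1 ≤ j ≤ q} contains both a position in the first column (j = 1) and a position in the last row (i = p) — equivalently, if max(0, p−q) ≤ t ≤ p−1 — then Σ_{(i,j) ∈ D_t} c_{ij} = 0; all other diagonals are unconstrained. -/

import Mathlib

open Matrix

/-- The `r × r` nilpotent upper-triangular Jordan block `J_r` (1 on the superdiagonal). -/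
def jordanBlock (F : Type*) [Zero F] [One F] (r : ℕ) (lam : F) :
    Matrix (Fin r) (Fin r) F :=
  Matrix.of fun i j =>
    if (i : ℕ) = (j : ℕ) then lam else if (j : ℕ) = (i : ℕ) + 1 then 1 else 0

/-- Extension of a matrix by zero to all pairs of natural numbers. -/
def Matrix.zeroExtend {F : Type*} [Zero F] {p q : ℕ} (C : Matrix (Fin p) (Fin q) F)
    (i j : ℕ) : F :=
  if h : i < p ∧ j < q then C ⟨i, h.1⟩ ⟨j, h.2⟩ else 0

section zeroExtend

variable {F : Type*} {p q : ℕ}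

theorem Matrix.zeroExtend_apply [Zero F] (C : Matrix (Fin p) (Fin q) F) (i : Fin p) (j : Fin q) :
    C.zeroExtend i j = C i j := by
  simp [Matrix.zeroExtend]

theorem Matrix.zeroExtend_of_le_left [Zero F] (C : Matrix (Fin p) (Fin q) F) {i : ℕ} (j : ℕ)
    (h : p ≤ i) : C.zeroExtend i j = 0 :=
  dif_neg fun h' => by omega

theorem Matrix.zeroExtend_of [Zero F] (s : ℕ → ℕ → F) {i j : ℕ} (hi : i < p) (hj : j < q) :
    (Matrix.of fun (i : Fin p) (j : Fin q) => s i j).zeroExtend i j = s i j := by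
  simp [Matrix.zeroExtend, hi, hj]

theorem mul_jordanBlock_zero_apply [NonAssocSemiring F] (S : Matrix (Fin p) (Fin q) F)
    (i : Fin p) (j : Fin q) :
    (S * jordanBlock F q 0) i j = if (j : ℕ) = 0 then 0 else S.zeroExtend i (j - 1) := by
  have key : ∀ k : Fin q, S i k * jordanBlock F q 0 k j =
      if (j : ℕ) = k + 1 then S i k else 0 := by
    intro k
    simp only [jordanBlock, Matrix.of_apply]
    split_ifs <;> first | omega | simp
  rw [Matrix.mul_apply, Finset.sum_congr rfl fun k _ => key k]
  split_ifs with h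
  · exact Finset.sum_eq_zero fun k _ => if_neg (by omega)
  · have hj : (j : ℕ) - 1 < q := by omega
    rw [Finset.sum_eq_single (⟨(j : ℕ) - 1, hj⟩ : Fin q), if_pos (by simp only; omega)]
    · exact (S.zeroExtend_apply i ⟨(j : ℕ) - 1, hj⟩).symm
    · intro k _ hk
      refine if_neg fun h' => hk (Fin.ext ?_)
      simp only
      omega
    · simp

theorem jordanBlock_zero_mul_apply [NonAssocSemiring F] (S : Matrix (Fin p) (Fin q) F)
    (i : Fin p) (j : Fin q) :
    (jordanBlock F p 0 * S) i j = S.zeroExtend (i + 1) j := by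
  have key : ∀ k : Fin p, jordanBlock F p 0 i k * S k j =
      if (k : ℕ) = i + 1 then S k j else 0 := by
    intro k
    simp only [jordanBlock, Matrix.of_apply]
    split_ifs <;> first | omega | simp
  rw [Matrix.mul_apply, Finset.sum_congr rfl fun k _ => key k]
  by_cases h : (i : ℕ) + 1 < p
  · rw [Finset.sum_eq_single (⟨(i : ℕ) + 1, h⟩ : Fin p), if_pos rfl]
    · exact (S.zeroExtend_apply ⟨(i : ℕ) + 1, h⟩ j).symm
    · exact fun k _ hk => if_neg fun h' => hk (Fin.ext h')
    · simp
  · rw [S.zeroExtend_of_le_left _ (by omega)]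
    exact Finset.sum_eq_zero fun k _ => if_neg (by omega)

theorem sum_diagonal_eq_sum_zeroExtend [AddCommMonoid F] (C : Matrix (Fin p) (Fin q) F) (d : ℕ) :
    ∑ i : Fin p, ∑ j : Fin q, (if (i : ℤ) - (j : ℤ) = d then C i j else 0) =
      ∑ k ∈ Finset.range q, C.zeroExtend (d + k) k := by
  rw [Finset.sum_comm, ← Fin.sum_univ_eq_sum_range (fun k => C.zeroExtend (d + k) k)]
  refine Finset.sum_congr rfl fun j _ => ?_
  by_cases h : d + (j : ℕ) < p
  · rw [Finset.sum_eq_single (⟨d + (j : ℕ), h⟩ : Fin p), if_pos (by simp)]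
    · exact (C.zeroExtend_apply ⟨d + (j : ℕ), h⟩ j).symm
    · intro k _ hk
      refine if_neg fun h' => hk (Fin.ext ?_)
      simp only
      omega
    · simp
  · rw [C.zeroExtend_of_le_left _ (by omega)]
    exact Finset.sum_eq_zero fun k _ => if_neg (by omega)

theorem sum_zeroExtend_mul_jordanBlock_sub [Ring F] (S : Matrix (Fin p) (Fin q) F) {d : ℕ}
    (hd : p ≤ d + q) :
    ∑ k ∈ Finset.range q,
      (S * jordanBlock F q 0 - jordanBlock F p 0 * S).zeroExtend (d + k) k = 0 := by
  let T : ℕ → F := fun k => if k = 0 then 0 else S.zeroExtend (d + k) (k - 1)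
  have key : ∀ k ∈ Finset.range q,
      (S * jordanBlock F q 0 - jordanBlock F p 0 * S).zeroExtend (d + k) k = T k - T (k + 1) := by
    intro k hk
    have hk := Finset.mem_range.1 hk
    by_cases h : d + k < p
    · have := Matrix.zeroExtend_apply (S * jordanBlock F q 0 - jordanBlock F p 0 * S)
        ⟨d + k, h⟩ ⟨k, hk⟩
      simp only at this
      rw [this, Matrix.sub_apply, mul_jordanBlock_zero_apply, jordanBlock_zero_mul_apply]
      simp [T, add_assoc]
    · have h₁ : p ≤ d + k := by omega
      have h₂ : p ≤ d + (k + 1) := by omega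
      simp [T, Matrix.zeroExtend_of_le_left, h₁, h₂]
  rw [Finset.sum_congr rfl key, Finset.sum_range_sub']
  have h₀ : T q = 0 := by simp [T, Matrix.zeroExtend_of_le_left, hd]
  simp [h₀, T]

theorem exists_eq_mul_jordanBlock_sub [Ring F] (C : Matrix (Fin p) (Fin q) F)
    (hC : ∀ d : ℕ, p ≤ d + q → d < p →
      ∑ k ∈ Finset.range q, C.zeroExtend (d + k) k = 0) :
    ∃ S : Matrix (Fin p) (Fin q) F, C = S * jordanBlock F q 0 - jordanBlock F p 0 * S := by
  let s : ℕ → ℕ → F := fun i j =>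
    if j < i then -∑ k ∈ Finset.range (j + 1), C.zeroExtend (i - 1 - j + k) k
    else ∑ k ∈ Finset.range p, C.zeroExtend (i + k) (j + 1 + k)
  have last : ∀ j < q, s p j = 0 := by
    intro j hj
    by_cases h : j < p
    · simp only [s, if_pos h, neg_eq_zero]
      rw [← hC (p - 1 - j) (by omega) (by omega)]
      refine Finset.sum_subset (Finset.range_mono (by omega)) fun k _ hk => ?_
      exact C.zeroExtend_of_le_left _ (by rw [Finset.mem_range] at hk; omega)
    · simp only [s, if_neg h]
      exact Finset.sum_eq_zero fun k _ => C.zeroExtend_of_le_left _ (by omega)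
  refine ⟨Matrix.of fun i j => s i j, ?_⟩
  ext i j
  have hi := i.isLt
  have hj := j.isLt
  have hs : (Matrix.of fun (i : Fin p) (j : Fin q) => s i j).zeroExtend (i + 1) j =
      s (i + 1) j := by
    rcases Nat.lt_or_ge ((i : ℕ) + 1) p with h | h
    · exact Matrix.zeroExtend_of s h hj
    · rw [Matrix.zeroExtend_of_le_left _ _ h, show (i : ℕ) + 1 = p by omega, last _ hj]
  rw [Matrix.sub_apply, mul_jordanBlock_zero_apply, jordanBlock_zero_mul_apply, hs,
    Matrix.zeroExtend_of s hi (by omega), ← C.zeroExtend_apply i j]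
  generalize (i : ℕ) = a at *
  generalize (j : ℕ) = b at *
  rcases Nat.lt_or_ge a b with h | h
  · obtain ⟨b, rfl⟩ : ∃ b', b = b' + 1 := ⟨b - 1, by omega⟩
    have h₁ : ¬ b < a := by omega
    have h₂ : ¬ b + 1 < a + 1 := by omega
    simp only [s, Nat.add_sub_cancel, if_neg h₁, if_neg h₂, Nat.add_one_ne_zero, if_false]
    have hsum := (Finset.sum_range_succ (fun k => C.zeroExtend (a + k) (b + 1 + k)) p).symm.trans
      (Finset.sum_range_succ' (fun k => C.zeroExtend (a + k) (b + 1 + k)) p)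
    rw [C.zeroExtend_of_le_left _ (by omega : p ≤ a + p), add_zero] at hsum
    have shift : ∀ k, C.zeroExtend (a + 1 + k) (b + 1 + 1 + k) =
        C.zeroExtend (a + (k + 1)) (b + 1 + (k + 1)) := fun k => by
      congr 1 <;> omega
    simp only [hsum, shift, add_sub_cancel_left, add_zero]
  · obtain ⟨d, rfl⟩ := Nat.exists_eq_add_of_le' h
    cases b with
    | zero => simp [s]
    | succ b =>
      have h₁ : b < d + (b + 1) := by omega
      have h₂ : b + 1 < d + (b + 1) + 1 := by omega
      have e₁ : d + (b + 1) - 1 - b = d := by omega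
      have e₂ : d + (b + 1) + 1 - 1 - (b + 1) = d := by omega
      simp only [s, Nat.add_sub_cancel, if_pos h₁, if_pos h₂, Nat.add_one_ne_zero, if_false]
      simp only [Nat.add_sub_cancel] at e₁ e₂
      rw [e₁, Finset.sum_range_succ _ (b + 1)]
      simp

end zeroExtend

/-- The image of `S ↦ S J_q − J_p S` consists exactly of the matrices `C` such that for
every diagonal `D_t = {(i,j) : i − j = t}` that meets both the first column and the last
row (equivalently `max(0, p−q) ≤ t ≤ p−1`, in 0-indexed form), the sum of the entries of
`C` on that diagonal is zero. -/
theorem image_jordan_commutator (F : Type*) [RCLike F] (p q : ℕ)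
    (hp : 1 ≤ p) (hq : 1 ≤ q) (C : Matrix (Fin p) (Fin q) F) :
    (∃ S : Matrix (Fin p) (Fin q) F,
        C = S * jordanBlock F q 0 - jordanBlock F p 0 * S) ↔
    (∀ d : ℤ, max 0 ((p : ℤ) - q) ≤ d → d ≤ (p : ℤ) - 1 →
        ∑ i : Fin p, ∑ j : Fin q, (if (i : ℤ) - (j : ℤ) = d then C i j else 0) = 0) := by
  constructor
  · rintro ⟨S, rfl⟩ d hd _
    lift d to ℕ using (le_max_left _ _).trans hd
    rw [sum_diagonal_eq_sum_zeroExtend]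
    exact sum_zeroExtend_mul_jordanBlock_sub S (by omega)
  · intro h
    refine exists_eq_mul_jordanBlock_sub C fun d hd hdp => ?_
    rw [← sum_diagonal_eq_sum_zeroExtend]
    exact h d (by omega) (by omega)
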